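/- Let (X, 𝒜, μ) be a probability space, let g ∈ L¹(X, μ), and let P : L¹(X, μ) → L¹(X, μ) be a continuous linear operator such that P1 = 1 and such that for every f ∈ L¹(X, μ) the sequence (Pᵐf)_{m∈ℕ} converges in L¹(X, μ) to the constant function ∫_X f dμ. Then the equation φ = Pφ + g has a solution φ ∈ L¹(X, μ) if and only if the series ∑_{m=0}^∞ Pᵐg converges in L¹(X, μ); moreover, a function φ ∈ L¹(X, μ) solves φ = Pφ + g if and only if φ = ∑_{m=0}^∞ Pᵐg + c (equality μ-a.e.) for some real constant c. -/

import Mathlib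

open MeasureTheory Filter Topology

/-- Let `(X, 𝒜, μ)` be a probability space, `g ∈ L¹(X, μ)`, and let
`P : L¹ → L¹` be a continuous linear operator with `P 1 = 1` such that for every
`f ∈ L¹` the iterates `Pᵐ f` converge in `L¹` to the constant function `∫ f dμ`.
Then `φ = P φ + g` has a solution in `L¹` iff the series `∑ₘ Pᵐ g` converges in `L¹`;
moreover `φ ∈ L¹` solves the equation iff `φ = ∑ₘ Pᵐ g + c` for some real constant `c`. -/
theorem stmt0 {X : Type*} [MeasurableSpace X] (μ : Measure X) [IsProbabilityMeasure μ]
    (g : Lp ℝ 1 μ) (P : Lp ℝ 1 μ →L[ℝ] Lp ℝ 1 μ)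
    (hP1 : P (Lp.const 1 μ (1 : ℝ)) = Lp.const 1 μ (1 : ℝ))
    (hPm : ∀ f : Lp ℝ 1 μ,
      Tendsto (fun m : ℕ => (P ^ m) f) atTop (𝓝 (Lp.const 1 μ (∫ x, f x ∂μ)))) :
    ((∃ φ : Lp ℝ 1 μ, φ = P φ + g) ↔
      ∃ s : Lp ℝ 1 μ,
        Tendsto (fun M : ℕ => ∑ m ∈ Finset.range M, (P ^ m) g) atTop (𝓝 s)) ∧
    (∀ φ : Lp ℝ 1 μ, φ = P φ + g ↔
      ∃ c : ℝ, Tendsto (fun M : ℕ => ∑ m ∈ Finset.range M, (P ^ m) g) atTop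
        (𝓝 (φ - Lp.const 1 μ c))) := by
  have hconst : ∀ c : ℝ, P (Lp.const 1 μ c) = Lp.const 1 μ c := by
    intro c
    have h : Lp.const 1 μ c = c • Lp.const 1 μ (1 : ℝ) := by
      have := (Lp.constₗ (μ := μ) 1 ℝ : ℝ →ₗ[ℝ] Lp ℝ 1 μ).map_smul c 1
      simpa using this
    rw [h, map_smul, hP1]
  have hfwd : ∀ φ : Lp ℝ 1 μ, φ = P φ + g →
      Tendsto (fun M : ℕ => ∑ m ∈ Finset.range M, (P ^ m) g) atTop
        (𝓝 (φ - Lp.const 1 μ (∫ x, φ x ∂μ))) := by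
    intro φ hφ
    have hg : g = φ - P φ := eq_sub_of_add_eq' hφ.symm
    have hS : ∀ M : ℕ, ∑ m ∈ Finset.range M, (P ^ m) g = φ - (P ^ M) φ := by
      intro M
      induction M with
      | zero => simp
      | succ k ih =>
        have h1 : (P ^ (k + 1)) φ = (P ^ k) (P φ) := by
          rw [pow_succ]; rfl
        rw [Finset.sum_range_succ, ih, h1, hg, map_sub]
        abel
    simp only [hS]
    exact tendsto_const_nhds.sub (hPm φ)
  have hbwd : ∀ s : Lp ℝ 1 μ,
      Tendsto (fun M : ℕ => ∑ m ∈ Finset.range M, (P ^ m) g) atTop (𝓝 s) →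
      s = P s + g := by
    intro s hs
    have h1 := ((P.continuous.tendsto s).comp hs).add_const g
    have h2 := (tendsto_add_atTop_iff_nat 1).2 hs
    refine tendsto_nhds_unique h2 (h1.congr ?_)
    intro M
    simp only [Function.comp_apply, map_sum]
    rw [Finset.sum_range_succ']
    congr 1
    refine Finset.sum_congr rfl fun m _ => ?_
    rw [pow_succ' P m]
    rfl
  refine ⟨⟨fun ⟨φ, hφ⟩ => ⟨_, hfwd φ hφ⟩, fun ⟨s, hs⟩ => ⟨s, hbwd s hs⟩⟩, fun φ =>
    ⟨fun hφ => ⟨_, hfwd φ hφ⟩, ?_⟩⟩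
  rintro ⟨c, hc⟩
  have h := hbwd _ hc
  rw [map_sub, hconst, sub_add_eq_add_sub] at h
  exact sub_left_injective h
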